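/- arXiv:1410.6395 — 6 statements merged into one kernel-verified Lean document; each statement's English description precedes it below -/
import Mathlib

section
/- Let (𝒜, W_𝒜) be a pair consisting of a bicategory and a class of morphisms satisfying conditions (BF), let ℬ be a bicategory, and let F: 𝒜 → ℬ be a pseudofunctor sending every morphism of W_𝒜 to an internal equivalence of ℬ. Then the following two conditions on F are equivalent. (i) (condition (A1) with respect to (W_𝒜, W_{ℬ,min})): for every object A_ℬ of ℬ there exist objects A_𝒜 of 𝒜 and A'_ℬ of ℬ and morphisms w¹: A'_ℬ → F₀(A_𝒜) in W_{ℬ,min} and w²: A'_ℬ → A_ℬ in the right saturation (W_{ℬ,min})_sat. (ii) (condition (B1)): for every object A_ℬ of ℬ there exist an object A_𝒜 of 𝒜 and an internal equivalence e: F₀(A_𝒜) → A_ℬ. -/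
open CategoryTheory Bicategory

/-- A class of 1-morphisms in a bicategory. -/
abbrev MorphClass (C : Type*) [Bicategory C] :=
  ∀ ⦃a b : C⦄, (a ⟶ b) → Prop

/-- An internal equivalence in a bicategory: a morphism `e : a ⟶ b` admitting a
morphism `e' : b ⟶ a` and invertible 2-morphisms `id_a ⇒ e' ∘ e` and `e ∘ e' ⇒ id_b`. -/
def IsInternalEquiv {C : Type*} [Bicategory C] {a b : C} (e : a ⟶ b) : Prop :=
  ∃ e' : b ⟶ a, Nonempty (𝟙 a ≅ e ≫ e') ∧ Nonempty (e' ≫ e ≅ 𝟙 b)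

/-- The class of quasi-units of a bicategory: morphisms `f : a ⟶ a` admitting an
invertible 2-morphism `f ⇒ id_a`. -/
def QuasiUnits (C : Type*) [Bicategory C] : MorphClass C :=
  fun a b f => ∃ h : b = a, Nonempty (cast (congrArg (fun x => a ⟶ x) h) f ≅ 𝟙 a)

/-- The right saturation of a class of morphisms `W`: all `f : b ⟶ a` such that
there are `g : c ⟶ b` and `h : d ⟶ c` with both `f ∘ g` and `g ∘ h` in `W`. -/
def RightSat {C : Type*} [Bicategory C] (W : MorphClass C) : MorphClass C :=
  fun b a f => ∃ (c d : C) (g : c ⟶ b) (h : d ⟶ c), W (g ≫ f) ∧ W (h ≫ g)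

/-- Conditions (BF) for a pair consisting of a bicategory and a class of morphisms. -/
structure SatisfiesBF (C : Type*) [Bicategory C] (W : MorphClass C) : Prop where
  /-- (BF1): identities belong to `W`. -/
  bf1 : ∀ c : C, W (𝟙 c)
  /-- (BF2): `W` is closed under composition. -/
  bf2 : ∀ ⦃a b c : C⦄ (f : a ⟶ b) (g : b ⟶ c), W f → W g → W (f ≫ g)
  /-- (BF3) -/
  bf3 : ∀ ⦃a b c : C⦄ (w : a ⟶ b) (f : c ⟶ b), W w →
    ∃ (d : C) (v : d ⟶ c) (g : d ⟶ a), W v ∧ Nonempty (v ≫ f ≅ g ≫ w)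
  /-- (BF4) -/
  bf4 : ∀ ⦃a b c : C⦄ (w : b ⟶ a) (f₁ f₂ : c ⟶ b), W w →
    ∀ α : f₁ ≫ w ⟶ f₂ ≫ w,
    (∃ (d : C) (v : d ⟶ c) (β : v ≫ f₁ ⟶ v ≫ f₂), W v ∧
      v ◁ α = (α_ v f₁ w).inv ≫ β ▷ w ≫ (α_ v f₂ w).hom ∧
      (IsIso α → IsIso β)) ∧
    (∀ (d d' : C) (v : d ⟶ c) (v' : d' ⟶ c)
      (β : v ≫ f₁ ⟶ v ≫ f₂) (β' : v' ≫ f₁ ⟶ v' ≫ f₂),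
      W v → W v' →
      v ◁ α = (α_ v f₁ w).inv ≫ β ▷ w ≫ (α_ v f₂ w).hom →
      v' ◁ α = (α_ v' f₁ w).inv ≫ β' ▷ w ≫ (α_ v' f₂ w).hom →
      ∃ (e : C) (u : e ⟶ d) (u' : e ⟶ d'), W (u ≫ v) ∧
        ∃ ζ : u ≫ v ≅ u' ≫ v',
          (α_ u v f₁).inv ≫ ζ.hom ▷ f₁ ≫ (α_ u' v' f₁).hom ≫ u' ◁ β' =
            u ◁ β ≫ (α_ u v f₂).inv ≫ ζ.hom ▷ f₂ ≫ (α_ u' v' f₂).hom)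
  /-- (BF5): `W` is closed under invertible 2-morphisms. -/
  bf5 : ∀ ⦃a b : C⦄ (v w : a ⟶ b), W v → Nonempty (v ≅ w) → W w

theorem quasiUnits_iff_nonempty_iso {C : Type*} [Bicategory C] {a : C} (f : a ⟶ a) :
    QuasiUnits C f ↔ Nonempty (f ≅ 𝟙 a) :=
  ⟨fun ⟨_, hf⟩ => hf, fun hf => ⟨rfl, hf⟩⟩

/-- The right saturation of the class of quasi-units is the class of internal equivalences. -/
theorem rightSat_quasiUnits_iff {C : Type*} [Bicategory C] {b a : C} (f : b ⟶ a) :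
    RightSat (QuasiUnits C) f ↔ IsInternalEquiv f := by
  constructor
  · rintro ⟨c, d, g, h, hgf, hhg⟩
    obtain rfl : a = c := hgf.1
    obtain rfl : b = d := hhg.1
    obtain ⟨i⟩ := (quasiUnits_iff_nonempty_iso _).1 hgf
    obtain ⟨j⟩ := (quasiUnits_iff_nonempty_iso _).1 hhg
    have k : h ≅ f :=
      (ρ_ h).symm ≪≫ whiskerLeftIso h i.symm ≪≫ (α_ h g f).symm ≪≫ whiskerRightIso j f ≪≫ λ_ f
    exact ⟨g, ⟨j.symm ≪≫ whiskerRightIso k g⟩, ⟨i⟩⟩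
  · rintro ⟨e, ⟨i⟩, hi⟩
    exact ⟨a, b, e, f, (quasiUnits_iff_nonempty_iso _).2 hi,
      (quasiUnits_iff_nonempty_iso _).2 ⟨i.symm⟩⟩

/-- Condition (A1) with respect to `(W_𝒜, W_{ℬ,min})` is equivalent to
condition (B1), for a pseudofunctor sending each morphism of `W_𝒜` to an internal
equivalence, where `(𝒜, W_𝒜)` satisfies conditions (BF). -/
theorem statement0 {A : Type*} {B : Type*} [Bicategory A] [Bicategory B]
    (WA : MorphClass A) (hWA : SatisfiesBF A WA)
    (F : Pseudofunctor A B)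
    (hF : ∀ ⦃a b : A⦄ (w : a ⟶ b), WA w → IsInternalEquiv (F.map w)) :
    (∀ Ab : B, ∃ (Aa : A) (A'b : B) (w₁ : A'b ⟶ F.obj Aa) (w₂ : A'b ⟶ Ab),
        QuasiUnits B w₁ ∧ RightSat (QuasiUnits B) w₂)
    ↔ (∀ Ab : B, ∃ (Aa : A) (e : F.obj Aa ⟶ Ab), IsInternalEquiv e) := by
  constructor
  · intro h Ab
    obtain ⟨Aa, A'b, w₁, w₂, ⟨rfl, -⟩, hw₂⟩ := h Ab
    exact ⟨Aa, w₂, (rightSat_quasiUnits_iff w₂).1 hw₂⟩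
  · intro h Ab
    obtain ⟨Aa, e, he⟩ := h Ab
    exact ⟨Aa, F.obj Aa, 𝟙 _, e, (quasiUnits_iff_nonempty_iso _).2 ⟨Iso.refl _⟩,
      (rightSat_quasiUnits_iff e).2 he⟩
end

section
/- Let (𝒜, W_𝒜) be a pair consisting of a bicategory and a class of morphisms satisfying conditions (BF), let ℬ be a bicategory, and let F: 𝒜 → ℬ be a pseudofunctor sending every morphism of W_𝒜 to an internal equivalence of ℬ. Then the following two conditions on F are equivalent. (i) (condition (A4) with respect to (W_𝒜, W_{ℬ,min})): for all objects A_𝒜, B_𝒜 of 𝒜, all morphisms f¹, f²: A_𝒜 → B_𝒜, all 2-morphisms γ¹, γ²: f¹ ⇒ f², every object A'_ℬ of ℬ and every morphism z: A'_ℬ → F₀(A_𝒜) in W_{ℬ,min}, if F₂(γ¹) ∗ i_z = F₂(γ²) ∗ i_z then there exist an object A'_𝒜 and a morphism z_𝒜: A'_𝒜 → A_𝒜 in W_𝒜 such that γ¹ ∗ i_{z_𝒜} = γ² ∗ i_{z_𝒜}. (ii) (condition (B4)): for all objects A_𝒜, B_𝒜 of 𝒜, all morphisms f¹, f²: A_𝒜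 → B_𝒜 and all 2-morphisms γ¹, γ²: f¹ ⇒ f² with F₂(γ¹) = F₂(γ²), there exist an object A'_𝒜 and a morphism z_𝒜: A'_𝒜 → A_𝒜 in W_𝒜 such that γ¹ ∗ i_{z_𝒜} = γ² ∗ i_{z_𝒜}. -/
open CategoryTheory Bicategory

/-- Whiskering by a quasi-unit is injective on 2-morphisms. -/
theorem QuasiUnits.whiskerLeft_injective {C : Type*} [Bicategory C] {a b c : C} {z : a ⟶ b}
    (hz : QuasiUnits C z) {f g : b ⟶ c} {η θ : f ⟶ g} (h : z ◁ η = z ◁ θ) : η = θ := by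
  obtain ⟨rfl, ⟨e⟩⟩ := hz
  rw [cast_eq] at e
  have key : 𝟙 b ◁ η = 𝟙 b ◁ θ := by
    rw [← cancel_epi (e.hom ▷ f), ← whisker_exchange, ← whisker_exchange, h]
  simpa [id_whiskerLeft] using key

theorem QuasiUnits.id {C : Type*} [Bicategory C] (a : C) : QuasiUnits C (𝟙 a) :=
  ⟨rfl, ⟨Iso.refl _⟩⟩

/-- Condition (A4) with respect to `(W_𝒜, W_{ℬ,min})` is equivalent to
condition (B4). -/
theorem statement3 {A : Type*} {B : Type*} [Bicategory A] [Bicategory B]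
    (WA : MorphClass A) (hWA : SatisfiesBF A WA)
    (F : Pseudofunctor A B)
    (hF : ∀ ⦃a b : A⦄ (w : a ⟶ b), WA w → IsInternalEquiv (F.map w)) :
    (∀ (Aa Ba : A) (f₁ f₂ : Aa ⟶ Ba) (γ₁ γ₂ : f₁ ⟶ f₂) (A'b : B)
        (z : A'b ⟶ F.obj Aa), QuasiUnits B z →
        z ◁ F.map₂ γ₁ = z ◁ F.map₂ γ₂ →
        ∃ (A'a : A) (za : A'a ⟶ Aa), WA za ∧ za ◁ γ₁ = za ◁ γ₂)
    ↔ (∀ (Aa Ba : A) (f₁ f₂ : Aa ⟶ Ba) (γ₁ γ₂ : f₁ ⟶ f₂),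
        F.map₂ γ₁ = F.map₂ γ₂ →
        ∃ (A'a : A) (za : A'a ⟶ Aa), WA za ∧ za ◁ γ₁ = za ◁ γ₂) := by
  constructor
  · intro h Aa Ba f₁ f₂ γ₁ γ₂ hγ
    exact h Aa Ba f₁ f₂ γ₁ γ₂ _ (𝟙 (F.obj Aa)) (QuasiUnits.id _) (by rw [hγ])
  · intro h Aa Ba f₁ f₂ γ₁ γ₂ _ z hz hγ
    exact h Aa Ba f₁ f₂ γ₁ γ₂ (hz.whiskerLeft_injective hγ)
end

section
/- Let (𝒜, W_𝒜) be a pair consisting of a bicategory and a class of morphisms satisfying conditions (BF), let ℬ be a bicategory, and let F: 𝒜 → ℬ be a pseudofunctor sending every morphism of W_𝒜 to an internal equivalence of ℬ. Then the following two conditions on F are equivalent. (i) (condition (A5) with respect to (W_𝒜, W_{ℬ,min})): for all objects A_𝒜, B_𝒜 of 𝒜, every object A_ℬ of ℬ, all morphisms f¹, f²: A_𝒜 → B_𝒜, every morphism v: A_ℬ → F₀(A_𝒜) in W_{ℬ,min} and every 2-morphism α: F₁(f¹) ∘ v ⇒ F₁(f²) ∘ v, there exist objects A'_𝒜 of 𝒜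 and A'_ℬ of ℬ, morphisms v_𝒜: A'_𝒜 → A_𝒜 in W_𝒜, z: A'_ℬ → F₀(A'_𝒜) in W_{ℬ,min} and z': A'_ℬ → A_ℬ, a 2-morphism α_𝒜: f¹ ∘ v_𝒜 ⇒ f² ∘ v_𝒜 and an invertible 2-morphism σ: F₁(v_𝒜) ∘ z ⇒ v ∘ z', such that α ∗ i_{z'} = θ_{F₁(f²),v,z'} ⊙ (i_{F₁(f²)} ∗ σ) ⊙ (θ_{F₁(f²),F₁(v_𝒜),z})⁻¹ ⊙ ((ψ^F_{f²,v_𝒜} ⊙ F₂(α_𝒜) ⊙ (ψ^F_{f¹,v_𝒜})⁻¹) ∗ i_z) ⊙ θ_{F₁(f¹),F₁(v_𝒜),z} ⊙ (i_{F₁(f¹)} ∗ σ⁻¹) ⊙ (θ_{F₁(f¹),v,z'})⁻¹. (ii) (condition (B5)): for all objects A_𝒜, B_𝒜 of 𝒜, all morphisms f¹, f²: A_𝒜 → B_𝒜 and every 2-morphism α: F₁(f¹) ⇒ F₁(f²), there exist an object A'_𝒜, a morphism v: A'_𝒜 → A_𝒜 in W_𝒜 and a 2-morphism α_𝒜: f¹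 ∘ v ⇒ f² ∘ v such that α ∗ i_{F₁(v)} = ψ^F_{f²,v} ⊙ F₂(α_𝒜) ⊙ (ψ^F_{f¹,v})⁻¹. -/
open CategoryTheory Bicategory

namespace CategoryTheory.Bicategory

variable {C : Type*} [Bicategory C]

/-- Precomposition with a quasi-unit is bijective on 2-morphisms. -/
theorem whiskerLeft_bijective_of_iso_id {a b : C} {e : a ⟶ a} (φ : e ≅ 𝟙 a) (f g : a ⟶ b) :
    Function.Bijective (fun η : f ⟶ g => e ◁ η) := by
  have key (η : f ⟶ g) : e ◁ η =
      φ.hom ▷ f ≫ (λ_ f).hom ≫ η ≫ (λ_ g).inv ≫ φ.inv ▷ g := by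
    have h : 𝟙 a ◁ η = (λ_ f).hom ≫ η ≫ (λ_ g).inv := id_whiskerLeft η
    rw [← cancel_mono (φ.hom ▷ g), whisker_exchange, h]
    simp
  constructor
  · intro η η' h
    have : IsIso (φ.hom ▷ f) := inferInstance
    have : IsIso (φ.inv ▷ g) := inferInstance
    simpa [key, cancel_epi, cancel_mono] using h
  · intro α
    refine ⟨(λ_ f).inv ≫ φ.inv ▷ f ≫ α ≫ φ.hom ▷ g ≫ (λ_ g).hom, ?_⟩
    simp [key]

/-- Transporting along `σ : z ≫ w ≅ z' ≫ v` an identity between whiskered 2-morphisms. -/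
theorem whiskerLeft_whiskerLeft_eq_conj_iff {a b b' c d : C} {z : a ⟶ b} {w : b ⟶ c}
    {z' : a ⟶ b'} {v : b' ⟶ c} (σ : z ≫ w ≅ z' ≫ v) {f g : c ⟶ d} (η : f ⟶ g)
    (γ : w ≫ f ⟶ w ≫ g) :
    z' ◁ v ◁ η = (α_ z' v f).inv ≫ σ.inv ▷ f ≫ (α_ z w f).hom ≫ z ◁ γ ≫
        (α_ z w g).inv ≫ σ.hom ▷ g ≫ (α_ z' v g).hom ↔
      z ◁ w ◁ η = z ◁ γ := by
  have key : z' ◁ v ◁ η = (α_ z' v f).inv ≫ σ.inv ▷ f ≫ (α_ z w f).hom ≫ z ◁ w ◁ η ≫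
      (α_ z w g).inv ≫ σ.hom ▷ g ≫ (α_ z' v g).hom := by
    have h : σ.inv ▷ f ≫ (z ≫ w) ◁ η ≫ σ.hom ▷ g = (z' ≫ v) ◁ η := by
      rw [← whisker_exchange_assoc, ← comp_whiskerRight]
      simp
    have h' : z' ◁ v ◁ η = (α_ z' v f).inv ≫ (z' ≫ v) ◁ η ≫ (α_ z' v g).hom := by simp
    rw [h', ← h]
    simp
  rw [key]
  have : IsIso (σ.inv ▷ f) := inferInstance
  have : IsIso (σ.hom ▷ g) := inferInstance
  simp [cancel_epi, ← Category.assoc, cancel_mono]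

end CategoryTheory.Bicategory

/-- Condition (A5) with respect to `(W_𝒜, W_{ℬ,min})` is equivalent to
condition (B5). -/
theorem statement4 {A : Type*} {B : Type*} [Bicategory A] [Bicategory B]
    (WA : MorphClass A) (hWA : SatisfiesBF A WA)
    (F : Pseudofunctor A B)
    (hF : ∀ ⦃a b : A⦄ (w : a ⟶ b), WA w → IsInternalEquiv (F.map w)) :
    (∀ (Aa Ba : A) (Ab : B) (f₁ f₂ : Aa ⟶ Ba) (v : Ab ⟶ F.obj Aa),
        QuasiUnits B v →
        ∀ α : v ≫ F.map f₁ ⟶ v ≫ F.map f₂,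
        ∃ (A'a : A) (A'b : B) (va : A'a ⟶ Aa) (z : A'b ⟶ F.obj A'a) (z' : A'b ⟶ Ab),
          WA va ∧ QuasiUnits B z ∧
          ∃ (αa : va ≫ f₁ ⟶ va ≫ f₂) (σ : z ≫ F.map va ≅ z' ≫ v),
            z' ◁ α =
              (α_ z' v (F.map f₁)).inv ≫
              σ.inv ▷ F.map f₁ ≫
              (α_ z (F.map va) (F.map f₁)).hom ≫
              z ◁ ((F.mapComp va f₁).inv ≫ F.map₂ αa ≫ (F.mapComp va f₂).hom) ≫
              (α_ z (F.map va) (F.map f₂)).inv ≫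
              σ.hom ▷ F.map f₂ ≫
              (α_ z' v (F.map f₂)).hom)
    ↔ (∀ (Aa Ba : A) (f₁ f₂ : Aa ⟶ Ba) (α : F.map f₁ ⟶ F.map f₂),
        ∃ (A'a : A) (v : A'a ⟶ Aa), WA v ∧
          ∃ αa : v ≫ f₁ ⟶ v ≫ f₂,
            F.map v ◁ α =
              (F.mapComp v f₁).inv ≫ F.map₂ αa ≫ (F.mapComp v f₂).hom) := by
  constructor
  · intro h Aa Ba f₁ f₂ α
    obtain ⟨A'a, A'b, va, z, z', hva, ⟨e, ⟨φ⟩⟩, αa, σ, hσ⟩ :=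
      h Aa Ba (F.obj Aa) f₁ f₂ (𝟙 _) ⟨rfl, ⟨Iso.refl _⟩⟩ (𝟙 _ ◁ α)
    subst e
    rw [whiskerLeft_whiskerLeft_eq_conj_iff] at hσ
    exact ⟨A'a, va, hva, αa, (whiskerLeft_bijective_of_iso_id φ _ _).injective hσ⟩
  · rintro h Aa Ba Ab f₁ f₂ v ⟨e, ⟨φ⟩⟩ α
    subst e
    obtain ⟨α, rfl⟩ := (whiskerLeft_bijective_of_iso_id φ _ _).surjective α
    obtain ⟨A'a, va, hva, αa, hα⟩ := h Aa Ba f₁ f₂ α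
    refine ⟨A'a, F.obj A'a, va, 𝟙 _, F.map va, hva, ⟨rfl, ⟨Iso.refl _⟩⟩, αa,
      λ_ (F.map va) ≪≫ (ρ_ (F.map va)).symm ≪≫ whiskerLeftIso (F.map va) φ.symm, ?_⟩
    exact (whiskerLeft_whiskerLeft_eq_conj_iff _ _ _).2 (by rw [hα])
end

section
/- Let (𝒜, W_𝒜) be a pair consisting of a bicategory and a class of morphisms satisfying conditions (BF), let ℬ be a bicategory, and let F: 𝒜 → ℬ be a pseudofunctor that sends every morphism of W_𝒜 to an internal equivalence of ℬ and satisfies conditions (EF1), (EF2) and (EF3). Then F satisfies all of the following five conditions. (B1): for every object A_ℬ of ℬ there exist an object A_𝒜 of 𝒜 and an internal equivalence e: F₀(A_𝒜) → A_ℬ. (B2): for every pair of objects A¹_𝒜, A²_𝒜 of 𝒜 and every internal equivalence e: F₀(A¹_𝒜) → F₀(A²_𝒜), there exist an object A³_𝒜, morphisms u¹: A³_𝒜 → A¹_𝒜 in W_𝒜 and u²: A³_𝒜 → A²_𝒜 in (W_𝒜)_sat, an internal equivalence e': F₀(A¹_𝒜) → F₀(A³_𝒜) and invertible 2-morphisms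 δ¹: F₁(u¹) ∘ e' ⇒ id_{F₀(A¹_𝒜)} and δ²: e ⇒ F₁(u²) ∘ e'. (B3): for every pair of objects B_𝒜 of 𝒜 and A_ℬ of ℬ and every morphism f: A_ℬ → F₀(B_𝒜), there exist an object A_𝒜, a morphism f_𝒜: A_𝒜 → B_𝒜, an internal equivalence e: A_ℬ → F₀(A_𝒜) and an invertible 2-morphism α: f ⇒ F₁(f_𝒜) ∘ e. (B4): for all objects A_𝒜, B_𝒜 of 𝒜, all morphisms f¹, f²: A_𝒜 → B_𝒜 and all 2-morphisms γ¹, γ²: f¹ ⇒ f² with F₂(γ¹) = F₂(γ²), there exist an object A'_𝒜 and a morphism z_𝒜: A'_𝒜 → A_𝒜 in W_𝒜 such that γ¹ ∗ i_{z_𝒜} = γ² ∗ i_{z_𝒜}. (B5): for all objects A_𝒜, B_𝒜 of 𝒜, all morphisms f¹, f²: A_𝒜 → B_𝒜 and every 2-morphism α: F₁(f¹) ⇒ F₁(f²), there exist an object A'_𝒜, a morphism v: A'_𝒜 → A_𝒜 in W_𝒜 and a 2-morphism α_𝒜: f¹ ∘ v ⇒ f² ∘ v such that α ∗ i_{F₁(v)}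 = ψ^F_{f²,v} ⊙ F₂(α_𝒜) ⊙ (ψ^F_{f¹,v})⁻¹. -/
open CategoryTheory Bicategory

namespace IsInternalEquiv

variable {C : Type*} [Bicategory C] {a b c : C}

/-- A chosen quasi-inverse cancels on the left of a composite. -/
def cancelIso {e : a ⟶ b} {e' : b ⟶ a} (θ : e' ≫ e ≅ 𝟙 b) (f : b ⟶ c) : e' ≫ e ≫ f ≅ f :=
  (α_ e' e f).symm ≪≫ whiskerRightIso θ f ≪≫ λ_ f

theorem of_inverse {e : a ⟶ b} {e' : b ⟶ a} (η : 𝟙 a ≅ e ≫ e') (θ : e' ≫ e ≅ 𝟙 b) :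
    IsInternalEquiv e :=
  ⟨e', ⟨η⟩, ⟨θ⟩⟩

theorem comp {e : a ⟶ b} {f : b ⟶ c} (he : IsInternalEquiv e) (hf : IsInternalEquiv f) :
    IsInternalEquiv (e ≫ f) := by
  obtain ⟨e', ⟨η⟩, ⟨θ⟩⟩ := he
  obtain ⟨f', ⟨η'⟩, ⟨θ'⟩⟩ := hf
  refine of_inverse (e' := f' ≫ e') ?_ ?_
  · exact η ≪≫ whiskerLeftIso e (cancelIso η'.symm e').symm ≪≫
      (α_ e f (f' ≫ e')).symm
  · exact α_ f' e' (e ≫ f) ≪≫ whiskerLeftIso f' (cancelIso θ f) ≪≫ θ'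

theorem of_iso {e f : a ⟶ b} (he : IsInternalEquiv e) (φ : e ≅ f) : IsInternalEquiv f := by
  obtain ⟨e', ⟨η⟩, ⟨θ⟩⟩ := he
  exact of_inverse (η ≪≫ whiskerRightIso φ e') (whiskerLeftIso e' φ.symm ≪≫ θ)

theorem of_strict_inverse {e : a ⟶ b} {e' : b ⟶ a} (h : e ≫ e' = 𝟙 a) (h' : e' ≫ e = 𝟙 b) :
    IsInternalEquiv e :=
  of_inverse (eqToIso h.symm) (eqToIso h')

end IsInternalEquiv

section

variable {A B : Type*} [Bicategory A] [Bicategory B] {W : MorphClass A} (F : Pseudofunctor A B)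

/-- A pseudofunctor bijective on 2-morphisms reflects isomorphism of 1-morphisms. -/
theorem nonempty_iso_of_map_iso
    (hff : ∀ ⦃a b : A⦄ (f g : a ⟶ b) (α : F.map f ⟶ F.map g), ∃! β : f ⟶ g, F.map₂ β = α)
    {a b : A} {f g : a ⟶ b} (φ : F.map f ≅ F.map g) : Nonempty (f ≅ g) := by
  obtain ⟨p, hp, -⟩ := hff f g φ.hom
  obtain ⟨q, hq, -⟩ := hff g f φ.inv
  exact ⟨⟨p, q, (hff f f _).unique rfl (by simp [hp, hq]),
    (hff g g _).unique rfl (by simp [hp, hq])⟩⟩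

/-- A morphism sent to an internal equivalence can be precomposed into `W` by a morphism which is
itself sent to an internal equivalence. -/
theorem exists_comp_mem_of_map_isInternalEquiv
    (hiso : ∀ ⦃a b : A⦄ (v w : a ⟶ b), W v → Nonempty (v ≅ w) → W w)
    (hF : ∀ ⦃a b : A⦄ (w : a ⟶ b), W w → IsInternalEquiv (F.map w))
    (hlift : ∀ (a b : A) (f : F.obj a ⟶ F.obj b), ∃ (a' : A) (g : a' ⟶ b) (w : a' ⟶ a),
      W w ∧ Nonempty (F.map g ≅ F.map w ≫ f))
    (hff : ∀ ⦃a b : A⦄ (f g : a ⟶ b) (α : F.map f ⟶ F.map g), ∃! β : f ⟶ g, F.map₂ β = α)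
    {a b : A} {u : a ⟶ b} (hu : IsInternalEquiv (F.map u)) :
    ∃ (c : A) (g : c ⟶ a), W (g ≫ u) ∧ IsInternalEquiv (F.map g) := by
  obtain ⟨d, ⟨η⟩, ⟨θ⟩⟩ := hu
  obtain ⟨c, g, w, hw, ⟨φ⟩⟩ := hlift b a d
  refine ⟨c, g, hiso w _ hw (nonempty_iso_of_map_iso F hff ?_), ?_⟩
  · exact (F.mapComp g u ≪≫ whiskerRightIso φ (F.map u) ≪≫ α_ _ _ _ ≪≫
      whiskerLeftIso (F.map w) θ ≪≫ ρ_ _).symm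
  · exact ((hF w hw).comp (.of_inverse θ.symm η.symm)).of_iso φ.symm

theorem rightSat_of_map_isInternalEquiv
    (hiso : ∀ ⦃a b : A⦄ (v w : a ⟶ b), W v → Nonempty (v ≅ w) → W w)
    (hF : ∀ ⦃a b : A⦄ (w : a ⟶ b), W w → IsInternalEquiv (F.map w))
    (hlift : ∀ (a b : A) (f : F.obj a ⟶ F.obj b), ∃ (a' : A) (g : a' ⟶ b) (w : a' ⟶ a),
      W w ∧ Nonempty (F.map g ≅ F.map w ≫ f))
    (hff : ∀ ⦃a b : A⦄ (f g : a ⟶ b) (α : F.map f ⟶ F.map g), ∃! β : f ⟶ g, F.map₂ β = α)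
    {a b : A} {u : a ⟶ b} (hu : IsInternalEquiv (F.map u)) : RightSat W u := by
  obtain ⟨c, g, hgu, hg⟩ := exists_comp_mem_of_map_isInternalEquiv F hiso hF hlift hff hu
  obtain ⟨d, h, hhg, -⟩ := exists_comp_mem_of_map_isInternalEquiv F hiso hF hlift hff hg
  exact ⟨c, d, g, h, hgu, hhg⟩

end

/-- a pseudofunctor sending `W_𝒜` to internal equivalences and satisfying
(EF1), (EF2), (EF3) satisfies conditions (B1)-(B5). -/
theorem statement5 {A : Type*} {B : Type*} [Bicategory A] [Bicategory B]
    (WA : MorphClass A) (hWA : SatisfiesBF A WA)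
    (F : Pseudofunctor A B)
    (hF : ∀ ⦃a b : A⦄ (w : a ⟶ b), WA w → IsInternalEquiv (F.map w))
    (hEF1 : ∀ Ab : B, ∃ (Aa : A) (t : F.obj Aa ⟶ Ab) (t' : Ab ⟶ F.obj Aa),
      t ≫ t' = 𝟙 (F.obj Aa) ∧ t' ≫ t = 𝟙 Ab)
    (hEF2 : ∀ (Aa Ba : A) (f : F.obj Aa ⟶ F.obj Ba),
      ∃ (A'a : A) (fa : A'a ⟶ Ba) (w : A'a ⟶ Aa),
        WA w ∧ Nonempty (F.map fa ≅ F.map w ≫ f))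
    (hEF3 : ∀ ⦃Aa Ba : A⦄ (f₁ f₂ : Aa ⟶ Ba) (α : F.map f₁ ⟶ F.map f₂),
      ∃! αa : f₁ ⟶ f₂, F.map₂ αa = α) :
    -- (B1)
    ((∀ Ab : B, ∃ (Aa : A) (e : F.obj Aa ⟶ Ab), IsInternalEquiv e) ∧
    -- (B2)
    (∀ (A1 A2 : A) (e : F.obj A1 ⟶ F.obj A2), IsInternalEquiv e →
        ∃ (A3 : A) (u₁ : A3 ⟶ A1) (u₂ : A3 ⟶ A2) (e' : F.obj A1 ⟶ F.obj A3),
          WA u₁ ∧ RightSat WA u₂ ∧ IsInternalEquiv e' ∧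
          Nonempty (e' ≫ F.map u₁ ≅ 𝟙 (F.obj A1)) ∧
          Nonempty (e ≅ e' ≫ F.map u₂)) ∧
    -- (B3)
    (∀ (Ba : A) (Ab : B) (f : Ab ⟶ F.obj Ba),
        ∃ (Aa : A) (fa : Aa ⟶ Ba) (e : Ab ⟶ F.obj Aa),
          IsInternalEquiv e ∧ Nonempty (f ≅ e ≫ F.map fa)) ∧
    -- (B4)
    (∀ (Aa Ba : A) (f₁ f₂ : Aa ⟶ Ba) (γ₁ γ₂ : f₁ ⟶ f₂),
        F.map₂ γ₁ = F.map₂ γ₂ →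
        ∃ (A'a : A) (za : A'a ⟶ Aa), WA za ∧ za ◁ γ₁ = za ◁ γ₂) ∧
    -- (B5)
    (∀ (Aa Ba : A) (f₁ f₂ : Aa ⟶ Ba) (α : F.map f₁ ⟶ F.map f₂),
        ∃ (A'a : A) (v : A'a ⟶ Aa), WA v ∧
          ∃ αa : v ≫ f₁ ⟶ v ≫ f₂,
            F.map v ◁ α =
              (F.mapComp v f₁).inv ≫ F.map₂ αa ≫ (F.mapComp v f₂).hom)) := by
  refine ⟨fun Ab => ?_, fun A1 A2 e he => ?_, fun Ba Ab f => ?_, fun Aa Ba f₁ f₂ γ₁ γ₂ h => ?_,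
    fun Aa Ba f₁ f₂ α => ?_⟩
  · obtain ⟨Aa, t, t', h, h'⟩ := hEF1 Ab
    exact ⟨Aa, t, .of_strict_inverse h h'⟩
  · obtain ⟨A3, u, w, hw, ⟨φ⟩⟩ := hEF2 A1 A2 e
    obtain ⟨w', ⟨η⟩, ⟨θ⟩⟩ := hF w hw
    have hu : IsInternalEquiv (F.map u) := ((hF w hw).comp he).of_iso φ.symm
    exact ⟨A3, w, u, w', hw, rightSat_of_map_isInternalEquiv F hWA.bf5 hF hEF2 hEF3 hu,
      .of_inverse θ.symm η.symm, ⟨θ⟩,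
      ⟨(IsInternalEquiv.cancelIso θ e).symm ≪≫ whiskerLeftIso w' φ.symm⟩⟩
  · obtain ⟨A0, t, t', h, h'⟩ := hEF1 Ab
    obtain ⟨Aa, fa, w, hw, ⟨φ⟩⟩ := hEF2 A0 Ba (t ≫ f)
    obtain ⟨w', ⟨η⟩, ⟨θ⟩⟩ := hF w hw
    refine ⟨Aa, fa, t' ≫ w',
      (IsInternalEquiv.of_strict_inverse h' h).comp (.of_inverse θ.symm η.symm), ⟨Iso.symm ?_⟩⟩
    exact α_ t' w' (F.map fa) ≪≫ whiskerLeftIso t' (whiskerLeftIso w' φ ≪≫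
      IsInternalEquiv.cancelIso θ (t ≫ f)) ≪≫ IsInternalEquiv.cancelIso (eqToIso h') f
  · exact ⟨Aa, 𝟙 Aa, hWA.bf1 Aa, by rw [(hEF3 f₁ f₂ _).unique h rfl]⟩
  · obtain ⟨β, rfl, -⟩ := hEF3 f₁ f₂ α
    exact ⟨Aa, 𝟙 Aa, hWA.bf1 Aa, 𝟙 Aa ◁ β, by rw [F.map₂_whisker_left]; simp only [Category.assoc,
      Iso.inv_hom_id, Iso.inv_hom_id_assoc, Category.comp_id]⟩
end

section
/- Let (𝒜, W_𝒜) and (ℬ, W_ℬ) be pairs, each consisting of a bicategory and a class of morphisms, both satisfying conditions (BF), and let F: 𝒜 → ℬ be a pseudofunctor such that F₁ sends every morphism of W_𝒜 into the right saturation (W_ℬ)_sat. Assume F satisfies condition (A4): for all objects A_𝒜, B_𝒜 of 𝒜, all morphisms f¹, f²: A_𝒜 → B_𝒜, all 2-morphisms γ¹, γ²: f¹ ⇒ f², every object A'_ℬ of ℬ and every morphism z: A'_ℬ → F₀(A_𝒜) in W_ℬ, if F₂(γ¹) ∗ i_z = F₂(γ²) ∗ i_z then there exist an object A'_𝒜 and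 a morphism z_𝒜: A'_𝒜 → A_𝒜 in W_𝒜 such that γ¹ ∗ i_{z_𝒜} = γ² ∗ i_{z_𝒜}; and condition (A5): for all objects A_𝒜, B_𝒜 of 𝒜, every object A_ℬ of ℬ, all morphisms f¹, f²: A_𝒜 → B_𝒜, every morphism v: A_ℬ → F₀(A_𝒜) in W_ℬ and every 2-morphism α: F₁(f¹) ∘ v ⇒ F₁(f²) ∘ v, there exist objects A'_𝒜 of 𝒜 and A'_ℬ of ℬ, morphisms v_𝒜: A'_𝒜 → A_𝒜 in W_𝒜, z: A'_ℬ → F₀(A'_𝒜) in W_ℬ and z': A'_ℬ → A_ℬ, a 2-morphism α_𝒜: f¹ ∘ v_𝒜 ⇒ f² ∘ v_𝒜 and an invertible 2-morphism σ: F₁(v_𝒜) ∘ z ⇒ v ∘ z', such that α ∗ i_{z'} = θ_{F₁(f²),v,z'} ⊙ (i_{F₁(f²)} ∗ σ) ⊙ (θ_{F₁(f²),F₁(v_𝒜),z})⁻¹ ⊙ ((ψ^F_{f²,v_𝒜} ⊙ F₂(α_𝒜) ⊙ (ψ^F_{f¹,v_𝒜})⁻¹) ∗ i_z) ⊙ θ_{F₁(f¹),F₁(v_𝒜),z}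 ⊙ (i_{F₁(f¹)} ∗ σ⁻¹) ⊙ (θ_{F₁(f¹),v,z'})⁻¹. Then for every input datum of (A5) in which the given 2-morphism α: F₁(f¹) ∘ v ⇒ F₁(f²) ∘ v is invertible, there exists output data (A'_𝒜, A'_ℬ, v_𝒜 in W_𝒜, z in W_ℬ, z', α_𝒜, σ) satisfying all the requirements of condition (A5) listed above and such that, moreover, α_𝒜 is invertible. -/
open CategoryTheory Bicategory

section Comparison

variable {A : Type*} {B : Type*} [Bicategory A] [Bicategory B] (F : Pseudofunctor A B)

/-- The comparison `z' ≫ v ≫ F f ≅ z ≫ F (va ≫ f)` induced by a square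
`z ≫ F va ≅ z' ≫ v`. -/
def squareIso {a a' b : A} {x x' : B} {va : a' ⟶ a} {z : x' ⟶ F.obj a'} {z' : x' ⟶ x}
    {v : x ⟶ F.obj a} (σ : z ≫ F.map va ≅ z' ≫ v) (f : a ⟶ b) :
    z' ≫ v ≫ F.map f ≅ z ≫ F.map (va ≫ f) :=
  (α_ z' v (F.map f)).symm ≪≫ whiskerRightIso σ.symm (F.map f) ≪≫
    α_ z (F.map va) (F.map f) ≪≫ whiskerLeftIso z (F.mapComp va f).symm

theorem squareIso_conj {a a' b : A} {x x' : B} {va : a' ⟶ a} {z : x' ⟶ F.obj a'} {z' : x' ⟶ x}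
    {v : x ⟶ F.obj a} (σ : z ≫ F.map va ≅ z' ≫ v) {f₁ f₂ : a ⟶ b}
    (γ : va ≫ f₁ ⟶ va ≫ f₂) :
    (squareIso F σ f₁).hom ≫ z ◁ F.map₂ γ ≫ (squareIso F σ f₂).inv =
      (α_ z' v (F.map f₁)).inv ≫ σ.inv ▷ F.map f₁ ≫ (α_ z (F.map va) (F.map f₁)).hom ≫
        z ◁ ((F.mapComp va f₁).inv ≫ F.map₂ γ ≫ (F.mapComp va f₂).hom) ≫
        (α_ z (F.map va) (F.map f₂)).inv ≫ σ.hom ▷ F.map f₂ ≫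
        (α_ z' v (F.map f₂)).hom := by
  simp [squareIso]

theorem squareIso_naturality {a a' b : A} {x x' : B} {va : a' ⟶ a} {z : x' ⟶ F.obj a'}
    {z' : x' ⟶ x} {v : x ⟶ F.obj a} (σ : z ≫ F.map va ≅ z' ≫ v) {f₁ f₂ : a ⟶ b} (η : f₁ ⟶ f₂) :
    z' ◁ v ◁ F.map₂ η ≫ (squareIso F σ f₂).hom =
      (squareIso F σ f₁).hom ≫ z ◁ F.map₂ (va ◁ η) := by
  simp only [squareIso, Iso.trans_hom, Iso.symm_hom, whiskerRightIso_hom, whiskerLeftIso_hom,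
    Category.assoc, F.map₂_whisker_left, whiskerLeft_comp]
  rw [associator_inv_naturality_right_assoc, whisker_exchange_assoc,
    associator_naturality_right_assoc]
  simp only [← whiskerLeft_comp, Iso.inv_hom_id_assoc]

/-- Vertical pasting of squares. -/
def squarePaste {a a' a'' : A} {x x' x'' : B} {va : a' ⟶ a} {z : x' ⟶ F.obj a'} {z' : x' ⟶ x}
    {v : x ⟶ F.obj a} (σ : z ≫ F.map va ≅ z' ≫ v) {q : a'' ⟶ a'} {t : x'' ⟶ F.obj a''}
    {t' : x'' ⟶ x'} (ρ : t ≫ F.map q ≅ t' ≫ z) :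
    t ≫ F.map (q ≫ va) ≅ (t' ≫ z') ≫ v :=
  (squareIso F ρ va).symm ≪≫ whiskerLeftIso t' σ ≪≫ (α_ t' z' v).symm

theorem squareIso_paste {a a' a'' b : A} {x x' x'' : B} {va : a' ⟶ a} {z : x' ⟶ F.obj a'}
    {z' : x' ⟶ x} {v : x ⟶ F.obj a} (σ : z ≫ F.map va ≅ z' ≫ v) {q : a'' ⟶ a'}
    {t : x'' ⟶ F.obj a''} {t' : x'' ⟶ x'} (ρ : t ≫ F.map q ≅ t' ≫ z) (f : a ⟶ b) :
    squareIso F (squarePaste F σ ρ) f =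
      α_ t' z' (v ≫ F.map f) ≪≫ whiskerLeftIso t' (squareIso F σ f) ≪≫
        squareIso F ρ (va ≫ f) ≪≫ whiskerLeftIso t (F.map₂Iso (α_ q va f).symm) := by
  ext
  simp only [squareIso, squarePaste, Iso.trans_hom, Iso.symm_hom, whiskerRightIso_hom,
    whiskerLeftIso_hom, Iso.trans_inv, Iso.symm_inv, whiskerLeftIso_inv,
    Functor.mapIso_hom, PrelaxFunctor.mapFunctor_map,
    whiskerLeft_comp, comp_whiskerRight, Category.assoc]
  have h := congrArg (t ◁ ·) (F.mapComp_assoc_left_inv q va f)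
  simp only [whiskerLeft_comp] at h
  rw [associator_naturality_middle_assoc, h, associator_inv_naturality_right_assoc,
    whisker_exchange_assoc, associator_naturality_right_assoc]
  simp

/-- A 2-morphism `αa` representing `α` along a square still represents it, after whiskering,
along any pasted square. -/
theorem squareIso_restrict {a a' a'' b : A} {x x' x'' : B} {va : a' ⟶ a} {z : x' ⟶ F.obj a'}
    {z' : x' ⟶ x} {v : x ⟶ F.obj a} (σ : z ≫ F.map va ≅ z' ≫ v) {q : a'' ⟶ a'}
    {t : x'' ⟶ F.obj a''} {t' : x'' ⟶ x'} (ρ : t ≫ F.map q ≅ t' ≫ z) {f₁ f₂ : a ⟶ b}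
    {α : v ≫ F.map f₁ ⟶ v ≫ F.map f₂} {αa : va ≫ f₁ ⟶ va ≫ f₂}
    (h : z' ◁ α = (squareIso F σ f₁).hom ≫ z ◁ F.map₂ αa ≫ (squareIso F σ f₂).inv) :
    (t' ≫ z') ◁ α = (squareIso F (squarePaste F σ ρ) f₁).hom ≫
      t ◁ F.map₂ ((α_ q va f₁).hom ≫ q ◁ αa ≫ (α_ q va f₂).inv) ≫
      (squareIso F (squarePaste F σ ρ) f₂).inv := by
  have hρ : t ◁ F.map₂ (q ◁ αa) = (squareIso F ρ (va ≫ f₁)).inv ≫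
      t' ◁ z ◁ F.map₂ αa ≫ (squareIso F ρ (va ≫ f₂)).hom := by
    rw [squareIso_naturality, Iso.inv_hom_id_assoc]
  rw [comp_whiskerLeft, h, squareIso_paste, squareIso_paste]
  simp only [F.map₂_comp, whiskerLeft_comp, hρ, Iso.trans_hom, Iso.trans_inv, whiskerLeftIso_hom,
    whiskerLeftIso_inv, Functor.mapIso_hom, Functor.mapIso_inv, PrelaxFunctor.mapFunctor_map,
    Iso.symm_hom, Iso.symm_inv, Category.assoc]
  simp only [← whiskerLeft_comp_assoc, ← F.map₂_comp, Iso.inv_hom_id]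
  simp

end Comparison

theorem comp_whiskerLeft_eq {C : Type*} [Bicategory C] {a b c d : C} (g : a ⟶ b) {p : b ⟶ c}
    {f₁ f₂ : c ⟶ d} {γ₁ γ₂ : f₁ ⟶ f₂} (h : p ◁ γ₁ = p ◁ γ₂) :
    (g ≫ p) ◁ γ₁ = (g ≫ p) ◁ γ₂ := by
  rw [comp_whiskerLeft, comp_whiskerLeft, h]

theorem whiskerLeft_eq_of_iso {C : Type*} [Bicategory C] {a b c : C} {p q : a ⟶ b} (e : p ≅ q)
    {f₁ f₂ : b ⟶ c} {γ₁ γ₂ : f₁ ⟶ f₂} (h : q ◁ γ₁ = q ◁ γ₂) : p ◁ γ₁ = p ◁ γ₂ := by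
  rw [← cancel_mono (e.hom ▷ f₂), whisker_exchange, whisker_exchange, h]

/-- if `(𝒜, W_𝒜)` and `(ℬ, W_ℬ)` satisfy (BF), `F₁(W_𝒜) ⊆ (W_ℬ)_sat` and
`F` satisfies (A4) and (A5), then for every input datum of (A5) with invertible `α`
there is output data satisfying all the requirements of (A5) with `α_𝒜` invertible. -/
theorem statement7 {A : Type*} {B : Type*} [Bicategory A] [Bicategory B]
    (WA : MorphClass A) (WB : MorphClass B)
    (hWA : SatisfiesBF A WA) (hWB : SatisfiesBF B WB)
    (F : Pseudofunctor A B)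
    (hF : ∀ ⦃a b : A⦄ (w : a ⟶ b), WA w → RightSat WB (F.map w))
    -- condition (A4)
    (hA4 : ∀ (Aa Ba : A) (f₁ f₂ : Aa ⟶ Ba) (γ₁ γ₂ : f₁ ⟶ f₂) (A'b : B)
      (z : A'b ⟶ F.obj Aa), WB z →
      z ◁ F.map₂ γ₁ = z ◁ F.map₂ γ₂ →
      ∃ (A'a : A) (za : A'a ⟶ Aa), WA za ∧ za ◁ γ₁ = za ◁ γ₂)
    -- condition (A5)
    (hA5 : ∀ (Aa Ba : A) (Ab : B) (f₁ f₂ : Aa ⟶ Ba) (v : Ab ⟶ F.obj Aa),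
      WB v →
      ∀ α : v ≫ F.map f₁ ⟶ v ≫ F.map f₂,
      ∃ (A'a : A) (A'b : B) (va : A'a ⟶ Aa) (z : A'b ⟶ F.obj A'a) (z' : A'b ⟶ Ab),
        WA va ∧ WB z ∧
        ∃ (αa : va ≫ f₁ ⟶ va ≫ f₂) (σ : z ≫ F.map va ≅ z' ≫ v),
          z' ◁ α =
            (α_ z' v (F.map f₁)).inv ≫
            σ.inv ▷ F.map f₁ ≫
            (α_ z (F.map va) (F.map f₁)).hom ≫
            z ◁ ((F.mapComp va f₁).inv ≫ F.map₂ αa ≫ (F.mapComp va f₂).hom) ≫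
            (α_ z (F.map va) (F.map f₂)).inv ≫
            σ.hom ▷ F.map f₂ ≫
            (α_ z' v (F.map f₂)).hom) :
    ∀ (Aa Ba : A) (Ab : B) (f₁ f₂ : Aa ⟶ Ba) (v : Ab ⟶ F.obj Aa),
      WB v →
      ∀ α : v ≫ F.map f₁ ⟶ v ≫ F.map f₂, IsIso α →
      ∃ (A'a : A) (A'b : B) (va : A'a ⟶ Aa) (z : A'b ⟶ F.obj A'a) (z' : A'b ⟶ Ab),
        WA va ∧ WB z ∧
        ∃ (αa : va ≫ f₁ ⟶ va ≫ f₂) (σ : z ≫ F.map va ≅ z' ≫ v),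
          IsIso αa ∧
          z' ◁ α =
            (α_ z' v (F.map f₁)).inv ≫
            σ.inv ▷ F.map f₁ ≫
            (α_ z (F.map va) (F.map f₁)).hom ≫
            z ◁ ((F.mapComp va f₁).inv ≫ F.map₂ αa ≫ (F.mapComp va f₂).hom) ≫
            (α_ z (F.map va) (F.map f₂)).inv ≫
            σ.hom ▷ F.map f₂ ≫
            (α_ z' v (F.map f₂)).hom := by
  intro Aa Ba Ab f₁ f₂ v hv α hα
  obtain ⟨a₁, b₁, va, z, z', hva, hz, αa, σ, hσ⟩ := hA5 Aa Ba Ab f₁ f₂ v hv α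
  rw [← squareIso_conj] at hσ
  have hmap : z ◁ F.map₂ αa =
      (squareIso F σ f₁).inv ≫ z' ◁ α ≫ (squareIso F σ f₂).hom := by
    simp [hσ]
  have hiso : IsIso (z ◁ F.map₂ αa) := by
    rw [hmap]
    infer_instance
  obtain ⟨a₂, b₂, wa, y, y', hwa, hy, γa, τ, hτ⟩ :=
    hA5 a₁ Ba b₁ (va ≫ f₂) (va ≫ f₁) z hz (inv (z ◁ F.map₂ αa))
  rw [← squareIso_conj] at hτ
  have hγ : y ◁ F.map₂ γa = (squareIso F τ (va ≫ f₂)).inv ≫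
      y' ◁ inv (z ◁ F.map₂ αa) ≫ (squareIso F τ (va ≫ f₁)).hom := by
    simp [hτ]
  have hα' : y ◁ F.map₂ (wa ◁ αa) = (squareIso F τ (va ≫ f₁)).inv ≫
      y' ◁ z ◁ F.map₂ αa ≫ (squareIso F τ (va ≫ f₂)).hom := by
    rw [squareIso_naturality, Iso.inv_hom_id_assoc]
  have hinv₁ : y ◁ F.map₂ (wa ◁ αa ≫ γa) = y ◁ F.map₂ (𝟙 _) := by
    rw [F.map₂_comp, whiskerLeft_comp, hα', hγ]
    simp [← whiskerLeft_comp_assoc]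
  have hinv₂ : y ◁ F.map₂ (γa ≫ wa ◁ αa) = y ◁ F.map₂ (𝟙 _) := by
    rw [F.map₂_comp, whiskerLeft_comp, hα', hγ]
    simp [← whiskerLeft_comp_assoc]
  obtain ⟨a₃, p, hp, hp₁⟩ := hA4 _ _ _ _ _ _ _ y hy hinv₁
  obtain ⟨a₄, r, hr, hr₂⟩ := hA4 _ _ _ _ _ _ _ y hy hinv₂
  obtain ⟨a₅, k, g, hk, ⟨e⟩⟩ := hWA.bf3 p r hp
  have hu₁ : (k ≫ r) ◁ (wa ◁ αa ≫ γa) = 𝟙 _ := by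
    rw [whiskerLeft_eq_of_iso e (comp_whiskerLeft_eq g hp₁), whiskerLeft_id]
  have hu₂ : (k ≫ r) ◁ (γa ≫ wa ◁ αa) = 𝟙 _ := by
    rw [comp_whiskerLeft_eq k hr₂, whiskerLeft_id]
  rw [whiskerLeft_comp] at hu₁ hu₂
  have hu : IsIso ((k ≫ r) ◁ wa ◁ αa) := ⟨(k ≫ r) ◁ γa, hu₁, hu₂⟩
  have hq : IsIso (((k ≫ r) ≫ wa) ◁ αa) := by
    rw [comp_whiskerLeft]
    infer_instance
  obtain ⟨b₅, t, t', ht, ⟨ρ⟩⟩ := hWB.bf3 z (F.map ((k ≫ r) ≫ wa)) hz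
  refine ⟨a₅, b₅, ((k ≫ r) ≫ wa) ≫ va, t, t' ≫ z',
    hWA.bf2 _ _ (hWA.bf2 _ _ (hWA.bf2 _ _ hk hr) hwa) hva, ht,
    (α_ _ va f₁).hom ≫ ((k ≫ r) ≫ wa) ◁ αa ≫ (α_ _ va f₂).inv, squarePaste F σ ρ,
    inferInstance, ?_⟩
  rw [← squareIso_conj]
  exact squareIso_restrict F σ ρ hσ
end

section
/- Let (𝒜, W_𝒜) be a pair consisting of a bicategory and a class of morphisms satisfying conditions (BF), let ℬ be a bicategory, and let F: 𝒜 → ℬ be a pseudofunctor that sends every morphism of W_𝒜 to an internal equivalence of ℬ and satisfies conditions (EF1), (EF2) and (EF3). Then F satisfies condition (B3): for every pair of objects B_𝒜 of 𝒜 and A_ℬ of ℬ and every morphism f: A_ℬ → F₀(B_𝒜), there exist an object A_𝒜, a morphism f_𝒜: A_𝒜 → B_𝒜, an internal equivalence e: A_ℬ → F₀(A_𝒜) and an invertible 2-morphism α: f ⇒ F₁(f_𝒜) ∘ e. -/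
open CategoryTheory Bicategory

/-- The composite of two internal equivalences is an internal equivalence. -/
theorem IsInternalEquiv.comp_s11 {C : Type*} [Bicategory C] {a b c : C} {f : a ⟶ b} {g : b ⟶ c}
    (hf : IsInternalEquiv f) (hg : IsInternalEquiv g) : IsInternalEquiv (f ≫ g) := by
  obtain ⟨f', ⟨ηf⟩, ⟨θf⟩⟩ := hf
  obtain ⟨g', ⟨ηg⟩, ⟨θg⟩⟩ := hg
  refine ⟨g' ≫ f', ⟨?_⟩, ⟨?_⟩⟩
  · exact ηf ≪≫ whiskerLeftIso f ((λ_ f').symm ≪≫ whiskerRightIso ηg f' ≪≫ α_ g g' f') ≪≫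
      (α_ f g (g' ≫ f')).symm
  · exact α_ g' f' (f ≫ g) ≪≫ whiskerLeftIso g' ((α_ f' f g).symm ≪≫ whiskerRightIso θf g ≪≫
      λ_ g) ≪≫ θg

/-- A quasi-inverse of an internal equivalence is an internal equivalence. -/
theorem isInternalEquiv_of_isos {C : Type*} [Bicategory C] {a b : C} {e : a ⟶ b} {e' : b ⟶ a}
    (η : 𝟙 a ≅ e ≫ e') (θ : e' ≫ e ≅ 𝟙 b) : IsInternalEquiv e' :=
  ⟨e, ⟨θ.symm⟩, ⟨η.symm⟩⟩

/-- a pseudofunctor sending `W_𝒜` to internal equivalences and satisfying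
(EF1), (EF2), (EF3) satisfies condition (B3). -/
theorem statement11 {A : Type*} {B : Type*} [Bicategory A] [Bicategory B]
    (WA : MorphClass A) (hWA : SatisfiesBF A WA)
    (F : Pseudofunctor A B)
    (hF : ∀ ⦃a b : A⦄ (w : a ⟶ b), WA w → IsInternalEquiv (F.map w))
    (hEF1 : ∀ Ab : B, ∃ (Aa : A) (t : F.obj Aa ⟶ Ab) (t' : Ab ⟶ F.obj Aa),
      t ≫ t' = 𝟙 (F.obj Aa) ∧ t' ≫ t = 𝟙 Ab)
    (hEF2 : ∀ (Aa Ba : A) (f : F.obj Aa ⟶ F.obj Ba),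
      ∃ (A'a : A) (fa : A'a ⟶ Ba) (w : A'a ⟶ Aa),
        WA w ∧ Nonempty (F.map fa ≅ F.map w ≫ f))
    (hEF3 : ∀ ⦃Aa Ba : A⦄ (f₁ f₂ : Aa ⟶ Ba) (α : F.map f₁ ⟶ F.map f₂),
      ∃! αa : f₁ ⟶ f₂, F.map₂ αa = α) :
    ∀ (Ba : A) (Ab : B) (f : Ab ⟶ F.obj Ba),
      ∃ (Aa : A) (fa : Aa ⟶ Ba) (e : Ab ⟶ F.obj Aa),
        IsInternalEquiv e ∧ Nonempty (f ≅ e ≫ F.map fa) := by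
  intro Ba Ab f
  obtain ⟨Aa, t, t', htt', ht't⟩ := hEF1 Ab
  obtain ⟨A', fa, w, hw, ⟨φ⟩⟩ := hEF2 Aa Ba (t ≫ f)
  obtain ⟨e', ⟨η⟩, ⟨θ⟩⟩ := hF w hw
  have ht' : IsInternalEquiv t' := isInternalEquiv_of_isos (eqToIso htt'.symm) (eqToIso ht't)
  refine ⟨A', fa, t' ≫ e', ht'.comp_s11 (isInternalEquiv_of_isos η θ), ⟨Iso.symm ?_⟩⟩
  calc (t' ≫ e') ≫ F.map fa
      ≅ t' ≫ e' ≫ F.map fa := α_ _ _ _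
    _ ≅ t' ≫ e' ≫ F.map w ≫ t ≫ f := whiskerLeftIso t' (whiskerLeftIso e' φ)
    _ ≅ t' ≫ (e' ≫ F.map w) ≫ t ≫ f := whiskerLeftIso t' (α_ _ _ _).symm
    _ ≅ t' ≫ t ≫ f := whiskerLeftIso t' (whiskerRightIso θ (t ≫ f) ≪≫ λ_ (t ≫ f))
    _ ≅ (t' ≫ t) ≫ f := (α_ _ _ _).symm
    _ ≅ f := whiskerRightIso (eqToIso ht't) f ≪≫ λ_ f
end
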